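/- (Matrix Tree Theorem, cofactor version) For a finite graph G on vertex set {v_1, ..., v_n}, every cofactor of the Laplacian matrix equals the number of spanning trees: t(G) = (−1)^{i+j} · det(L_{(i,j)}(G)) for all i, j, where L_{(i,j)}(G) is L(G) with row i and column j removed. -/

import Mathlib

/-- The number of spanning trees of a simple graph `G`: spanning subgraphs (on the same
vertex set) that are trees. -/
noncomputable def spanningTreeCount {V : Type*} (G : SimpleGraph V) : ℕ :=
  Set.ncard {T : SimpleGraph V | T ≤ G ∧ T.IsTree}

open Matrix Finset

/-- Extend a function defined away from `r` to all of `V`, fixing `r`. -/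
def extendFixing {V : Type*} [DecidableEq V] (r : V) (h : {v // v ≠ r} → V) (v : V) : V :=
  if hv : v = r then r else h ⟨v, hv⟩

section extendFixing

variable {V : Type*} [DecidableEq V] {r : V}

@[simp]
theorem extendFixing_self (h : {v // v ≠ r} → V) : extendFixing r h r = r := by
  simp [extendFixing]

@[simp]
theorem extendFixing_coe (h : {v // v ≠ r} → V) (v : {v // v ≠ r}) :
    extendFixing r h v = h v := by
  simp [extendFixing, v.2]

@[simp]
theorem extendFixing_iterate_self (h : {v // v ≠ r} → V) (k : ℕ) :
    (extendFixing r h)^[k] r = r :=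
  Function.iterate_fixed (extendFixing_self h) k

/-- Every vertex is eventually mapped to the root `r`. -/
def LeadsTo (r : V) (h : {v // v ≠ r} → V) : Prop :=
  ∀ v, ∃ k, (extendFixing r h)^[k] v = r

theorem LeadsTo.apply_ne {h : {v // v ≠ r} → V} (hh : LeadsTo r h) (v : {v // v ≠ r}) :
    h v ≠ v := by
  intro e
  obtain ⟨k, hk⟩ := hh v
  rw [Function.iterate_fixed (by simpa using e) k] at hk
  exact v.2 hk

theorem LeadsTo.apply_apply_ne {h : {v // v ≠ r} → V} (hh : LeadsTo r h)
    (v w : {v // v ≠ r}) (hv : h v = w) : h w ≠ v := by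
  intro hw
  obtain ⟨k, hk⟩ := hh v
  have : ∀ k, (extendFixing r h)^[k] v = v ∨ (extendFixing r h)^[k] v = w := by
    intro k
    induction k with
    | zero => simp
    | succ k ih =>
      rw [Function.iterate_succ_apply']
      rcases ih with e | e <;> simp [e, hv, hw]
  rcases this k with e | e
  · exact v.2 (e.symm.trans hk)
  · exact w.2 (e.symm.trans hk)

/-- The transition matrix of `h` with the root row and column removed. -/
def parentMatrix (r : V) (h : {v // v ≠ r} → V) : Matrix {v // v ≠ r} {v // v ≠ r} ℝ :=
  Matrix.of fun v u => if h v = u then 1 else 0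

variable [Fintype V]

theorem parentMatrix_mulVec_apply (h : {v // v ≠ r} → V) (x : V → ℝ) (hx : x r = 0)
    (v : {v // v ≠ r}) : (parentMatrix r h *ᵥ fun u => x u) v = x (h v) := by
  simp only [mulVec, dotProduct, parentMatrix, of_apply, ite_mul, one_mul, zero_mul]
  by_cases hv : h v = r
  · rw [hv, hx]
    exact Finset.sum_eq_zero fun u _ => if_neg fun e => u.2 e.symm
  · rw [Finset.sum_eq_single ⟨h v, hv⟩]
    · simp
    · intro u _ hu
      exact if_neg fun e => hu (Subtype.ext e.symm)
    · simp

theorem parentMatrix_pow_apply (h : {v // v ≠ r} → V) (k : ℕ) (v u : {v // v ≠ r}) :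
    (parentMatrix r h ^ k) v u = if (extendFixing r h)^[k] v = u then 1 else 0 := by
  induction k generalizing v with
  | zero =>
    simp only [pow_zero, Matrix.one_apply, Subtype.ext_iff, Function.iterate_zero, id_eq]
    congr
  | succ k ih =>
    have key := parentMatrix_mulVec_apply h
      (fun w => if (extendFixing r h)^[k] w = u then 1 else 0) (by simp [u.2.symm]) v
    rw [pow_succ', Matrix.mul_apply, Function.iterate_succ_apply, extendFixing_coe, ← key]
    simp only [mulVec, dotProduct, ih]

theorem LeadsTo.isNilpotent_parentMatrix {h : {v // v ≠ r} → V} (hh : LeadsTo r h) :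
    IsNilpotent (parentMatrix r h) := by
  choose k hk using hh
  refine ⟨∑ v, k v, ?_⟩
  ext v u
  rw [parentMatrix_pow_apply, if_neg, Matrix.zero_apply]
  have hle : k v ≤ ∑ v, k v := Finset.single_le_sum (fun _ _ => Nat.zero_le _) (mem_univ _)
  rw [← Nat.sub_add_cancel hle, Function.iterate_add_apply, hk, extendFixing_iterate_self]
  exact u.2.symm

theorem det_one_sub_of_isNilpotent {n R : Type*} [Fintype n] [DecidableEq n] [CommRing R]
    [IsDomain R] {M : Matrix n n R} (hM : IsNilpotent M) : (1 - M).det = 1 := by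
  have h := (isNilpotent_charpoly_sub_pow_of_isNilpotent hM).eq_zero
  have := Matrix.eval_charpoly M 1
  rw [sub_eq_zero.mp h] at this
  simpa using this.symm

open Classical in
theorem det_one_sub_parentMatrix (h : {v // v ≠ r} → V) :
    (1 - parentMatrix r h).det = if LeadsTo r h then 1 else 0 := by
  split_ifs with hh
  · exact det_one_sub_of_isNilpotent hh.isNilpotent_parentMatrix
  · simp only [LeadsTo, not_forall] at hh
    obtain ⟨v, hv⟩ := hh
    have hvr : v ≠ r := fun e => hv ⟨0, e⟩
    rw [← exists_mulVec_eq_zero_iff]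
    let x : V → ℝ := fun w => if ∃ k, (extendFixing r h)^[k] w = r then 0 else 1
    have hxr : x r = 0 := if_pos ⟨0, rfl⟩
    refine ⟨fun w => x w, fun e => ?_, ?_⟩
    · have := congrFun e ⟨v, hvr⟩
      simp [x, hv] at this
    · ext w
      rw [sub_mulVec, one_mulVec, Pi.sub_apply, parentMatrix_mulVec_apply h x hxr, Pi.zero_apply,
        sub_eq_zero]
      have : (∃ k, (extendFixing r h)^[k] w = r) ↔ ∃ k, (extendFixing r h)^[k] (h w) = r := by
        constructor
        · rintro ⟨_ | k, hk⟩
          · exact absurd hk w.2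
          · exact ⟨k, by simpa using hk⟩
        · rintro ⟨k, hk⟩
          exact ⟨k + 1, by simpa using hk⟩
      simp only [x, this]

end extendFixing

namespace SimpleGraph

variable {V : Type*} {r : V}

/-- The graph joining every non-root vertex to its image under `h`. -/
def parentGraph (r : V) (h : {v // v ≠ r} → V) : SimpleGraph V :=
  fromEdgeSet (Set.range fun v : {v // v ≠ r} => s((v : V), h v))

theorem parentGraph_adj_apply {h : {v // v ≠ r} → V} (v : {v // v ≠ r}) (hv : h v ≠ v) :
    (parentGraph r h).Adj v (h v) := by
  rw [parentGraph, fromEdgeSet_adj]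
  exact ⟨⟨v, rfl⟩, hv.symm⟩

theorem parentGraph_le_iff {h : {v // v ≠ r} → V} (hne : ∀ v : {v // v ≠ r}, h v ≠ v)
    {G : SimpleGraph V} :
    parentGraph r h ≤ G ↔ ∀ v : {v // v ≠ r}, G.Adj v (h v) := by
  refine ⟨fun hle v => hle (parentGraph_adj_apply v (hne v)), fun hG => ?_⟩
  intro a b hab
  rw [parentGraph, fromEdgeSet_adj] at hab
  obtain ⟨⟨v, hv⟩, -⟩ := hab
  rw [← mem_edgeSet, ← hv]
  exact hG v

theorem Connected.exists_adj_dist_lt {T : SimpleGraph V} (hT : T.Connected) {v : V}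
    (hv : v ≠ r) : ∃ w, T.Adj v w ∧ T.dist w r < T.dist v r := by
  obtain ⟨p, hp⟩ := hT.exists_walk_length_eq_dist v r
  cases p with
  | nil => exact absurd rfl hv
  | cons hadj q =>
    refine ⟨_, hadj, ?_⟩
    rw [← hp, Walk.length_cons]
    exact Nat.lt_succ_of_le (dist_le q)

variable [DecidableEq V]

theorem connected_parentGraph {h : {v // v ≠ r} → V} (hh : LeadsTo r h) :
    (parentGraph r h).Connected := by
  have key : ∀ k v, (extendFixing r h)^[k] v = r → (parentGraph r h).Reachable v r := by
    intro k
    induction k with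
    | zero => exact fun v hv => by rw [show v = r from hv]
    | succ k ih =>
      intro v hv
      by_cases e : v = r
      · rw [e]
      · lift v to {v // v ≠ r} using e
        rw [Function.iterate_succ_apply, extendFixing_coe] at hv
        exact (parentGraph_adj_apply v (hh.apply_ne v)).reachable.trans (ih _ hv)
  have : Nonempty V := ⟨r⟩
  refine ⟨fun u v => ?_⟩
  obtain ⟨k, hk⟩ := hh u
  obtain ⟨l, hl⟩ := hh v
  exact (key k u hk).trans (key l v hl).symm

theorem isTree_parentGraph [Fintype V] {h : {v // v ≠ r} → V} (hh : LeadsTo r h) :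
    (parentGraph r h).IsTree := by
  have hc := connected_parentGraph hh
  refine isTree_iff_connected_and_card.mpr
    ⟨hc, le_antisymm ?_ hc.card_vert_le_card_edgeSet_add_one⟩
  have hsub : (parentGraph r h).edgeSet ⊆ Set.range fun v : {v // v ≠ r} => s((v : V), h v) := by
    rw [parentGraph, edgeSet_fromEdgeSet]
    exact Set.sdiff_subset
  have h1 := Set.ncard_le_ncard hsub (Set.toFinite _)
  have h2 : (Set.range fun v : {v // v ≠ r} => s((v : V), h v)).ncard ≤ Nat.card {v // v ≠ r} := by
    rw [← Set.image_univ, ← Set.ncard_univ]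
    exact Set.ncard_image_le (Set.toFinite _)
  have h3 : Nat.card {v // v ≠ r} + 1 = Nat.card V := by
    have : 0 < Fintype.card V := Fintype.card_pos_iff.mpr ⟨r⟩
    simp only [Nat.card_eq_fintype_card, ne_eq, Fintype.card_subtype_compl,
      Fintype.card_unique]
    omega
  rw [← h3]
  exact Nat.add_le_add_right (h1.trans h2) 1

theorem parentGraph_injOn : Set.InjOn (parentGraph r) {h | LeadsTo r h} := by
  intro f _ g (hg : LeadsTo r g) hfg
  have key : ∀ k (v : V), (extendFixing r g)^[k] v = r →
      extendFixing r f v = extendFixing r g v := by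
    intro k
    induction k with
    | zero => exact fun v hv => by simp [show v = r from hv]
    | succ k ih =>
      intro v hv
      by_cases e : v = r
      · simp [e]
      lift v to {v // v ≠ r} using e
      rw [Function.iterate_succ_apply] at hv
      have hgv := ih _ hv
      simp only [extendFixing_coe] at hgv ⊢
      have hadj := parentGraph_adj_apply v (hg.apply_ne v)
      rw [← hfg, parentGraph, fromEdgeSet_adj] at hadj
      obtain ⟨⟨x, hx⟩, -⟩ := hadj
      rcases Sym2.eq_iff.mp hx with ⟨hx1, hx2⟩ | ⟨hx1, hx2⟩
      · rwa [Subtype.ext hx1] at hx2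
      · rw [← hx1, extendFixing_coe, extendFixing_coe, hx2] at hgv
        exact absurd hgv.symm (hg.apply_apply_ne v x hx1.symm)
  funext v
  obtain ⟨k, hk⟩ := hg v
  simpa using key k v hk

theorem IsTree.exists_parentGraph_eq {T : SimpleGraph V} (hT : T.IsTree) (r : V) :
    ∃ h, LeadsTo r h ∧ parentGraph r h = T := by
  choose h hadj hlt using fun v : {v // v ≠ r} => hT.1.exists_adj_dist_lt v.2
  have hh : LeadsTo r h := by
    have key : ∀ d v, T.dist v r ≤ d → ∃ k, (extendFixing r h)^[k] v = r := by
      intro d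
      induction d with
      | zero =>
        intro v hv
        exact ⟨0, (hT.1.dist_eq_zero_iff).mp (Nat.le_zero.mp hv)⟩
      | succ d ih =>
        intro v hv
        by_cases e : v = r
        · exact ⟨0, e⟩
        · lift v to {v // v ≠ r} using e
          obtain ⟨k, hk⟩ := ih (h v) (by have := hlt v; omega)
          exact ⟨k + 1, by simpa using hk⟩
    exact fun v => key _ v le_rfl
  have hle : parentGraph r h ≤ T := (parentGraph_le_iff hh.apply_ne).mpr hadj
  exact ⟨h, hh, le_antisymm hle
    ((isTree_iff_minimal_connected.mp hT).2 (connected_parentGraph hh) hle)⟩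

theorem ncard_leadsTo_eq_spanningTreeCount [Fintype V] (G : SimpleGraph V) (r : V) :
    {h : {v // v ≠ r} → V | LeadsTo r h ∧ ∀ v : {v // v ≠ r}, G.Adj v (h v)}.ncard =
      spanningTreeCount G := by
  refine Set.BijOn.ncard_eq (f := parentGraph r) ⟨?_, ?_, ?_⟩
  · rintro h ⟨hh, hG⟩
    exact ⟨(parentGraph_le_iff hh.apply_ne).mpr hG, isTree_parentGraph hh⟩
  · exact parentGraph_injOn.mono fun h hh => hh.1
  · rintro T ⟨hTG, hT⟩
    obtain ⟨h, hh, rfl⟩ := hT.exists_parentGraph_eq r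
    exact ⟨h, ⟨hh, (parentGraph_le_iff hh.apply_ne).mp hTG⟩, rfl⟩

theorem lapMatrix_submatrix_eq_sum [Fintype V] (G : SimpleGraph V) [DecidableRel G.Adj] (r : V) :
    (G.lapMatrix ℝ).submatrix ((↑) : {v // v ≠ r} → V) ((↑) : {v // v ≠ r} → V) =
      fun v : {v // v ≠ r} => ∑ u : V, (if G.Adj v u then (1 : ℝ) else 0) •
        fun w : {v // v ≠ r} => (if v = w then (1 : ℝ) else 0) - if u = w then 1 else 0 := by
  ext v w
  simp only [submatrix_apply, lapMatrix, degMatrix, Matrix.sub_apply, adjMatrix_apply,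
    diagonal_apply, Finset.sum_apply, Pi.smul_apply, smul_eq_mul, mul_sub, Finset.sum_sub_distrib,
    ← Finset.sum_mul]
  rw [← degree_eq_sum_if_adj]
  simp [Subtype.ext_iff]

/-- The principal cofactor version of the matrix tree theorem. -/
theorem det_lapMatrix_submatrix_ne [Fintype V] (G : SimpleGraph V) [DecidableRel G.Adj] (r : V) :
    ((G.lapMatrix ℝ).submatrix ((↑) : {v // v ≠ r} → V) ((↑) : {v // v ≠ r} → V)).det =
      spanningTreeCount G := by
  classical
  rw [lapMatrix_submatrix_eq_sum, ← ncard_leadsTo_eq_spanningTreeCount G r]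
  change (detRowAlternating (R := ℝ)).toMultilinearMap _ = _
  rw [MultilinearMap.map_sum]
  simp only [MultilinearMap.map_smul_univ]
  have hM : ∀ h : {v // v ≠ r} → V, (detRowAlternating (R := ℝ)).toMultilinearMap
      (fun v w : {v // v ≠ r} => (if v = w then (1 : ℝ) else 0) - if h v = w then 1 else 0) =
      if LeadsTo r h then 1 else 0 := by
    intro h
    rw [← det_one_sub_parentMatrix]
    change Matrix.det _ = _
    congr 1
  simp only [hM, Finset.prod_boole, smul_eq_mul, ite_zero_mul_ite_zero, mul_one]
  rw [Finset.sum_boole, Set.ncard_eq_toFinset_card']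
  congr 2
  ext h
  simp [and_comm]

end SimpleGraph

/-- Matrix Tree Theorem (cofactor version): for a finite graph `G` on `n + 1` vertices,
every cofactor of the Laplacian matrix equals the number of spanning trees:
`t(G) = (−1)^(i+j) · det(L_{(i,j)}(G))`, where `L_{(i,j)}(G)` is the Laplacian with
row `i` and column `j` removed. -/
theorem treeCount_eq_cofactor {n : ℕ} (G : SimpleGraph (Fin (n + 1)))
    [DecidableRel G.Adj] (i j : Fin (n + 1)) :
    (spanningTreeCount G : ℝ) =
      (-1) ^ ((i : ℕ) + (j : ℕ)) *
        ((G.lapMatrix ℝ).submatrix i.succAbove j.succAbove).det := by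
  have hdiag : ((G.lapMatrix ℝ).submatrix i.succAbove i.succAbove).det = spanningTreeCount G := by
    rw [← G.det_lapMatrix_submatrix_ne i, ← det_submatrix_equiv_self (finSuccAboveEquiv i)]
    rfl
  have hrow : ∀ a, ∑ b, (G.lapMatrix ℝ).submatrix i.succAbove id a b = 0 := fun a => by
    simpa [mulVec, dotProduct] using congrFun (G.lapMatrix_mulVec_const_eq_zero (R := ℝ))
      (i.succAbove a)
  have hmove := submatrix_succAbove_det_eq_negOnePow_submatrix_succAbove_det'
    ((G.lapMatrix ℝ).submatrix i.succAbove id) hrow i j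
  simp only [submatrix_submatrix, Function.comp_id, Function.id_comp] at hmove
  rw [← hdiag, hmove, Int.negOnePow_sub, ← Int.negOnePow_add]
  rw [Units.smul_def, Int.negOnePow_def, zsmul_eq_mul, ← Nat.cast_add, zpow_natCast]
  push_cast
  rfl
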